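/- Each of the six snake boundary words evaluates to the identity matrix: (α·γ⁻¹·β⁻¹·γ⁻¹)²·β⁻¹·(α⁻¹·γ·β·γ)²·β = I, (γ⁻¹·β⁻¹·α⁻¹·β⁻¹)²·α⁻¹·(γ·β·α·β)²·α = I, (γ⁻¹·α·γ⁻¹·β⁻¹)²·α⁻¹·(γ·α⁻¹·γ·β)²·α = I, γ⁻¹·(β⁻¹·γ⁻¹·β⁻¹·α⁻¹)²·γ·(β·γ·β·α)² = I, β⁻¹·(α⁻¹·β⁻¹·α⁻¹·γ)²·β·(α·β·α·γ⁻¹)² = I, and γ⁻¹·(β⁻¹·α⁻¹·γ·α⁻¹)²·γ·(β·α·γ⁻¹·α)² = I. -/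

import Mathlib

open Matrix

/-- `ω = exp(2πi/12)`, a primitive 12th root of unity. -/
noncomputable def ω : ℂ := Complex.exp (2 * Real.pi * Complex.I / 12)

/-- The SL₂(ℂ) connection matrix on northeast edges. -/
noncomputable def α : Matrix (Fin 2) (Fin 2) ℂ := !![ω^7, 0; 0, ω^5]

/-- The SL₂(ℂ) connection matrix on northwest edges. -/
noncomputable def β : Matrix (Fin 2) (Fin 2) ℂ := !![ω^7, ω^3; 0, ω^5]

/-- The SL₂(ℂ) connection matrix on horizontal edges. -/
noncomputable def γ : Matrix (Fin 2) (Fin 2) ℂ := !![ω^5, 0; ω^3, ω^7]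

theorem ω_pow_four : ω ^ 4 = ω ^ 2 - 1 := by
  have hω : IsPrimitiveRoot ω 12 := by
    simpa [ω] using Complex.isPrimitiveRoot_exp 12 (by norm_num)
  have h : (ω ^ 6 - 1) * (ω ^ 2 + 1) * (ω ^ 4 - ω ^ 2 + 1) = 0 := by
    linear_combination hω.pow_eq_one
  have h₆ : ω ^ 6 - 1 ≠ 0 :=
    sub_ne_zero.2 (hω.pow_ne_one_of_pos_of_lt (by norm_num) (by norm_num))
  have h₂ : ω ^ 2 + 1 ≠ 0 := fun h₂ ↦
    hω.pow_ne_one_of_pos_of_lt (l := 4) (by norm_num) (by norm_num)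
      (by linear_combination (ω ^ 2 - 1) * h₂)
  linear_combination (mul_eq_zero.1 h).resolve_left (mul_ne_zero h₆ h₂)

theorem α_eq : α = !![-ω, 0; 0, ω ^ 3 - ω] := by
  have h := ω_pow_four
  ext i j
  fin_cases i <;> fin_cases j <;> simp [α] <;> grind

theorem β_eq : β = !![-ω, ω ^ 3; 0, ω ^ 3 - ω] := by
  have h := ω_pow_four
  ext i j
  fin_cases i <;> fin_cases j <;> simp [β] <;> grind

theorem γ_eq : γ = !![ω ^ 3 - ω, 0; ω ^ 3, -ω] := by
  have h := ω_pow_four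
  ext i j
  fin_cases i <;> fin_cases j <;> simp [γ] <;> grind

theorem det_α : α.det = 1 := by
  have h := ω_pow_four
  simp only [α_eq, det_fin_two_of]
  grind

theorem det_β : β.det = 1 := by
  have h := ω_pow_four
  simp only [β_eq, det_fin_two_of]
  grind

theorem det_γ : γ.det = 1 := by
  have h := ω_pow_four
  simp only [γ_eq, det_fin_two_of]
  grind

theorem α_inv : α⁻¹ = !![ω ^ 3 - ω, 0; 0, -ω] := by
  rw [inv_def, det_α, Ring.inverse_one, one_smul, α_eq, adjugate_fin_two_of]
  simp

theorem β_inv : β⁻¹ = !![ω ^ 3 - ω, -ω ^ 3; 0, -ω] := by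
  rw [inv_def, det_β, Ring.inverse_one, one_smul, β_eq, adjugate_fin_two_of]
  simp

theorem γ_inv : γ⁻¹ = !![-ω, 0; -ω ^ 3, ω ^ 3 - ω] := by
  rw [inv_def, det_γ, Ring.inverse_one, one_smul, γ_eq, adjugate_fin_two_of]
  simp

/-- Cayley–Hamilton for a traceless `2 × 2` matrix of determinant one. -/
theorem sq_eq_neg_one_of_trace_eq_zero_of_det_eq_one {R : Type*} [CommRing R]
    {M : Matrix (Fin 2) (Fin 2) R} (htr : M.trace = 0) (hdet : M.det = 1) : M ^ 2 = -1 := by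
  rw [trace_fin_two] at htr
  rw [det_fin_two] at hdet
  ext i j
  fin_cases i <;> fin_cases j <;> simp [sq, mul_apply, Fin.sum_univ_two] <;> grind

/-- The squares of the four-letter blocks occurring in the snake words. -/
theorem sq_blocks_eq_neg_one :
    (α * γ⁻¹ * β⁻¹ * γ⁻¹) ^ 2 = -1 ∧
    (α⁻¹ * γ * β * γ) ^ 2 = -1 ∧
    (γ⁻¹ * β⁻¹ * α⁻¹ * β⁻¹) ^ 2 = -1 ∧
    (γ * β * α * β) ^ 2 = -1 ∧
    (γ⁻¹ * α * γ⁻¹ * β⁻¹) ^ 2 = -1 ∧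
    (γ * α⁻¹ * γ * β) ^ 2 = -1 ∧
    (β⁻¹ * γ⁻¹ * β⁻¹ * α⁻¹) ^ 2 = -1 ∧
    (β * γ * β * α) ^ 2 = -1 ∧
    (α⁻¹ * β⁻¹ * α⁻¹ * γ) ^ 2 = -1 ∧
    (α * β * α * γ⁻¹) ^ 2 = -1 ∧
    (β⁻¹ * α⁻¹ * γ * α⁻¹) ^ 2 = -1 ∧
    (β * α * γ⁻¹ * α) ^ 2 = -1 := by
  have h := ω_pow_four
  refine ⟨?_, ?_, ?_, ?_, ?_, ?_, ?_, ?_, ?_, ?_, ?_, ?_⟩ <;>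
  · apply sq_eq_neg_one_of_trace_eq_zero_of_det_eq_one
    · simp only [↓α_inv, ↓β_inv, ↓γ_inv, α_eq, β_eq, γ_eq, mul_fin_two, trace_fin_two_of]
      grind
    · simp [det_nonsing_inv, det_α, det_β, det_γ]

/-- Each of the six snake boundary words evaluates to the identity matrix. -/
theorem snake_boundary_words_eq_one :
    (α * γ⁻¹ * β⁻¹ * γ⁻¹)^2 * β⁻¹ * (α⁻¹ * γ * β * γ)^2 * β = (1 : Matrix (Fin 2) (Fin 2) ℂ) ∧
    (γ⁻¹ * β⁻¹ * α⁻¹ * β⁻¹)^2 * α⁻¹ * (γ * β * α * β)^2 * α = (1 : Matrix (Fin 2) (Fin 2) ℂ) ∧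
    (γ⁻¹ * α * γ⁻¹ * β⁻¹)^2 * α⁻¹ * (γ * α⁻¹ * γ * β)^2 * α = (1 : Matrix (Fin 2) (Fin 2) ℂ) ∧
    γ⁻¹ * (β⁻¹ * γ⁻¹ * β⁻¹ * α⁻¹)^2 * γ * (β * γ * β * α)^2 = (1 : Matrix (Fin 2) (Fin 2) ℂ) ∧
    β⁻¹ * (α⁻¹ * β⁻¹ * α⁻¹ * γ)^2 * β * (α * β * α * γ⁻¹)^2 = (1 : Matrix (Fin 2) (Fin 2) ℂ) ∧
    γ⁻¹ * (β⁻¹ * α⁻¹ * γ * α⁻¹)^2 * γ * (β * α * γ⁻¹ * α)^2 = (1 : Matrix (Fin 2) (Fin 2) ℂ) := by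
  have hα : IsUnit α.det := by simp [det_α]
  have hβ : IsUnit β.det := by simp [det_β]
  have hγ : IsUnit γ.det := by simp [det_γ]
  obtain ⟨h₁, h₂, h₃, h₄, h₅, h₆, h₇, h₈, h₉, h₁₀, h₁₁, h₁₂⟩ := sq_blocks_eq_neg_one
  simp [h₁, h₂, h₃, h₄, h₅, h₆, h₇, h₈, h₉, h₁₀, h₁₁, h₁₂, nonsing_inv_mul α hα,
    nonsing_inv_mul β hβ, nonsing_inv_mul γ hγ]
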